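/- arXiv:1708.06584 — 2 statements merged into one kernel-verified Lean document; each statement's English description precedes it below -/
import Mathlib

section
/- Let κ be an infinite cardinal whose cofinality is greater than ω, regarded as an ordinal, and let s be a bounded transfinite sequence of reals of length κ. Then the set {ξ < κ : M̄(s|_ξ) = M̄(s)} (restricted to nonzero ξ) has a subset that is club in κ, i.e., a subset C of the ordinals below κ that is unbounded in κ and closed in κ (the supremum of every nonempty subset of C bounded below κ belongs to C). -/
open Ordinal

/-- The number `n` of full blocks in the standard decomposition `o = ω^σ·n + ρ`,
where `ω^σ = ω ^ log ω o` is the largest indecomposable ordinal `≤ o`. -/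
noncomputable def stdBlocks (o : Ordinal.{0}) : ℕ :=
  Cardinal.toNat (o / omega0 ^ log omega0 o).card

/-- The upper mean `M̄` of a transfinite sequence of reals.  A sequence of length `o`
is encoded as a total function `f : Ordinal → ℝ`; only the values of `f` at ordinals
`< o` are ever used.  It is defined by transfinite recursion on `o`:
(1) for `o = 1` it is `f 0`;
(2) for `o` indecomposable with `o > 1` (i.e. `o = ω^σ` with `σ > 0`) it is
    `limsup_{ξ → o} M̄(f|_ξ) = inf_{1 ≤ ζ < o} sup_{ζ ≤ ξ < o} M̄(f|_ξ)`;
(3) for decomposable `o`, writing `o = ω^σ·n + ρ` with `ρ < ω^σ`, it is the average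
    `(1/n) (M̄(s₀) + ⋯ + M̄(s_{n-1}))` of the upper means of the `n` consecutive
    blocks of `f` of length `ω^σ` (the remainder of length `ρ` is discarded). -/
noncomputable def upperMean (o : Ordinal.{0}) (f : Ordinal.{0} → ℝ) : ℝ :=
  if o = 1 then f 0
  else if h1 : 1 < o ∧ o = omega0 ^ log omega0 o then
    ⨅ ζ : Set.Ico (1 : Ordinal.{0}) o, ⨆ ξ : Set.Ico ζ.1 o, upperMean ξ.1 f
  else if h2 : 1 < o then
    ((stdBlocks o : ℝ))⁻¹ *
      ∑ i ∈ Finset.range (stdBlocks o),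
        upperMean (omega0 ^ log omega0 o)
          (fun ξ => f (omega0 ^ log omega0 o * (i : Ordinal) + ξ))
  else 0
termination_by o
decreasing_by
  · exact ξ.2.2
  · exact lt_of_le_of_ne (opow_log_le_self _ (zero_lt_one.trans h2).ne')
      fun h => h1 ⟨h2, h.symm⟩

/-- A transfinite sequence of reals of length `o` is bounded if its range
(on indices `< o`) is bounded in `ℝ`. -/
def SeqBounded (o : Ordinal.{0}) (f : Ordinal.{0} → ℝ) : Prop :=
  ∃ C : ℝ, ∀ ξ < o, |f ξ| ≤ C

/-- The concatenation `r ⊕ s` of a sequence `r` of length `a` with a sequence `s`: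
its first `a` entries are those of `r`, and its entry at `a + ξ'` is `s ξ'`. -/
noncomputable def concatSeq (a : Ordinal.{0}) (r s : Ordinal.{0} → ℝ) :
    Ordinal.{0} → ℝ :=
  fun ξ => if ξ < a then r ξ else s (ξ - a)

/-- An ordinal is indecomposable if it is nonzero and not the sum of two strictly
smaller ordinals. -/
def IsIndecomposable (o : Ordinal.{0}) : Prop :=
  o ≠ 0 ∧ ∀ b < o, ∀ c < o, b + c ≠ o

/-- The concatenation `s₀ ⊕ s₁ ⊕ ⋯ ⊕ s_{n-1}` of `n` sequences, each of length `β`;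
the result has length `β * n`. -/
noncomputable def concatN (β : Ordinal.{0}) :
    (n : ℕ) → (Fin n → Ordinal.{0} → ℝ) → Ordinal.{0} → ℝ
  | 0, _ => fun _ => 0
  | n + 1, s => concatSeq (β * n) (concatN β n (fun i => s i.castSucc)) (s (Fin.last n))

/-- `s / β`: given a sequence `s` whose length is `β * α`, the sequence of length `α`
whose `ι`-th entry is the upper mean of the `ι`-th consecutive block of `s` of
length `β`. -/
noncomputable def seqDiv (s : Ordinal.{0} → ℝ) (β : Ordinal.{0}) : Ordinal.{0} → ℝ :=
  fun ι => upperMean β (fun ξ => s (β * ι + ξ))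

/-- The lower mean `𝕄̲(s) = -M̄(-s)`. -/
noncomputable def lowerMean (o : Ordinal.{0}) (s : Ordinal.{0} → ℝ) : ℝ :=
  - upperMean o (fun ξ => - s ξ)

/-- A sequence `s` of length `o` has mean `c` when its upper and lower means both
equal `c`. -/
def HasMean (o : Ordinal.{0}) (s : Ordinal.{0} → ℝ) (c : ℝ) : Prop :=
  upperMean o s = c ∧ lowerMean o s = c

theorem natCast_lt_of_lt_stdBlocks {o : Ordinal.{0}} {i : ℕ} (hi : i < stdBlocks o) :
    (i : Ordinal.{0}) < o / omega0 ^ log omega0 o := by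
  by_contra! h
  have h2 := Cardinal.toNat_le_toNat (card_le_card h)
    (by rw [card_nat]; exact Cardinal.natCast_lt_aleph0)
  rw [card_nat, Cardinal.toNat_natCast] at h2
  exact absurd hi (not_lt.2 h2)

theorem opow_log_mul_add_lt {o : Ordinal.{0}} {i : ℕ} (hi : i < stdBlocks o) {ξ : Ordinal.{0}}
    (hξ : ξ < omega0 ^ log omega0 o) : omega0 ^ log omega0 o * (i : Ordinal) + ξ < o :=
  calc omega0 ^ log omega0 o * (i : Ordinal) + ξ
      < omega0 ^ log omega0 o * (i : Ordinal) + omega0 ^ log omega0 o := by gcongr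
    _ = omega0 ^ log omega0 o * Order.succ (i : Ordinal) := (mul_succ _ _).symm
    _ ≤ omega0 ^ log omega0 o * (o / omega0 ^ log omega0 o) := by
        gcongr
        exact Order.succ_le_of_lt (natCast_lt_of_lt_stdBlocks hi)
    _ ≤ o := mul_div_le _ _

theorem abs_upperMean_le {C : ℝ} (hC : 0 ≤ C) (o : Ordinal.{0}) (f : Ordinal.{0} → ℝ)
    (hf : ∀ ξ < o, |f ξ| ≤ C) : |upperMean o f| ≤ C := by
  induction o using WellFoundedLT.induction generalizing f with
  | ind o ih =>
  rw [upperMean]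
  split_ifs with h0 h1 h2
  · exact hf 0 (h0 ▸ zero_lt_one)
  · have key : ∀ ξ < o, |upperMean ξ f| ≤ C := fun ξ hξ =>
      ih ξ hξ f fun η hη => hf η (hη.trans hξ)
    have key2 : ∀ ζ : Set.Ico (1 : Ordinal.{0}) o,
        |⨆ ξ : Set.Ico ζ.1 o, upperMean ξ.1 f| ≤ C := by
      intro ζ
      have : Nonempty (Set.Ico ζ.1 o) := ⟨⟨ζ.1, le_rfl, ζ.2.2⟩⟩
      rw [abs_le]
      constructor
      · exact (abs_le.1 (key ζ.1 ζ.2.2)).1.trans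
          (le_ciSup (f := fun ξ : Set.Ico ζ.1 o => upperMean ξ.1 f)
            ⟨C, by rintro _ ⟨ξ, rfl⟩; exact (abs_le.1 (key ξ.1 ξ.2.2)).2⟩ ⟨ζ.1, le_rfl, ζ.2.2⟩)
      · exact ciSup_le fun ξ => (abs_le.1 (key ξ.1 ξ.2.2)).2
    have : Nonempty (Set.Ico (1 : Ordinal.{0}) o) := ⟨⟨1, le_rfl, h1.1⟩⟩
    rw [abs_le]
    constructor
    · exact le_ciInf fun ζ => (abs_le.1 (key2 ζ)).1
    · exact (ciInf_le ⟨-C, by rintro _ ⟨ζ, rfl⟩; exact (abs_le.1 (key2 ζ)).1⟩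
        ⟨1, le_rfl, h1.1⟩).trans (abs_le.1 (key2 ⟨1, le_rfl, h1.1⟩)).2
  · have hlt : omega0 ^ log omega0 o < o :=
      lt_of_le_of_ne (opow_log_le_self _ (zero_lt_one.trans h2).ne') fun h => h1 ⟨h2, h.symm⟩
    have hsum := Finset.abs_sum_le_sum_abs
      (fun i : ℕ => upperMean (omega0 ^ log omega0 o)
        (fun ξ => f (omega0 ^ log omega0 o * (i : Ordinal) + ξ))) (Finset.range (stdBlocks o))
    have hsum2 := Finset.sum_le_card_nsmul (Finset.range (stdBlocks o))
      (fun i : ℕ => |upperMean (omega0 ^ log omega0 o)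
        (fun ξ => f (omega0 ^ log omega0 o * (i : Ordinal) + ξ))|) C
      (fun i hi => ih _ hlt _ fun ξ hξ => hf _ (opow_log_mul_add_lt (Finset.mem_range.1 hi) hξ))
    rw [Finset.card_range, _root_.nsmul_eq_mul] at hsum2
    rw [abs_mul, abs_of_nonneg (by positivity : (0 : ℝ) ≤ (stdBlocks o : ℝ)⁻¹)]
    rcases Nat.eq_zero_or_pos (stdBlocks o) with h | h
    · simp [h, hC]
    · have : (0 : ℝ) < stdBlocks o := by exact_mod_cast h
      rw [inv_mul_le_iff₀ this]
      exact hsum.trans hsum2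
  · simpa using hC

theorem SeqBounded.exists_abs_upperMean_le {o : Ordinal.{0}} {f : Ordinal.{0} → ℝ}
    (hf : SeqBounded o f) : ∃ C, ∀ ξ ≤ o, |upperMean ξ f| ≤ C := by
  obtain ⟨C, hC⟩ := hf
  exact ⟨max C 0, fun ξ hξ => abs_upperMean_le (le_max_right _ _) _ _ fun η hη =>
    (hC η (hη.trans_le hξ)).trans (le_max_left _ _)⟩

theorem SeqBounded.mono {o p : Ordinal.{0}} {f : Ordinal.{0} → ℝ}
    (hf : SeqBounded o f) (h : p ≤ o) : SeqBounded p f :=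
  hf.imp fun _ hC ξ hξ => hC ξ (hξ.trans_le h)

theorem upperMean_eq_iInf_iSup {o : Ordinal.{0}} (h1 : 1 < o)
    (ho : IsPrincipal (· + ·) o) (f : Ordinal.{0} → ℝ) :
    upperMean o f = ⨅ ζ : Set.Ico (1 : Ordinal.{0}) o, ⨆ ξ : Set.Ico ζ.1 o, upperMean ξ.1 f := by
  have h : 1 < o ∧ o = omega0 ^ log omega0 o := by
    refine ⟨h1, ?_⟩
    rcases isPrincipal_add_iff_zero_or_omega0_opow.1 ho with rfl | ⟨x, rfl⟩
    · exact absurd h1 not_lt_zero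
    · simp only [log_opow one_lt_omega0]
  rw [upperMean, if_neg h1.ne', dif_pos h]

theorem exists_forall_upperMean_lt {o : Ordinal.{0}} (h1 : 1 < o)
    (ho : IsPrincipal (· + ·) o) {f : Ordinal.{0} → ℝ} (hf : SeqBounded o f) {c : ℝ}
    (hc : upperMean o f < c) : ∃ ζ < o, ∀ ξ, ζ ≤ ξ → ξ < o → upperMean ξ f < c := by
  obtain ⟨C, hC⟩ := hf.exists_abs_upperMean_le
  rw [upperMean_eq_iInf_iSup h1 ho] at hc
  have : Nonempty (Set.Ico (1 : Ordinal.{0}) o) := ⟨⟨1, le_rfl, h1⟩⟩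
  obtain ⟨ζ, hζ⟩ := exists_lt_of_ciInf_lt hc
  refine ⟨ζ.1, ζ.2.2, fun ξ h h' => lt_of_le_of_lt ?_ hζ⟩
  exact le_ciSup (f := fun ξ : Set.Ico ζ.1 o => upperMean ξ.1 f)
    ⟨C, by rintro _ ⟨η, rfl⟩; exact (abs_le.1 (hC η.1 η.2.2.le)).2⟩ ⟨ξ, h, h'⟩

theorem exists_lt_upperMean {o : Ordinal.{0}} (h1 : 1 < o)
    (ho : IsPrincipal (· + ·) o) {f : Ordinal.{0} → ℝ} (hf : SeqBounded o f) {c : ℝ}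
    (hc : c < upperMean o f) {ζ : Ordinal.{0}} (hζ : ζ < o) :
    ∃ ξ, ζ ≤ ξ ∧ ξ < o ∧ c < upperMean ξ f := by
  obtain ⟨C, hC⟩ := hf.exists_abs_upperMean_le
  rw [upperMean_eq_iInf_iSup h1 ho] at hc
  have hz : max ζ 1 < o := max_lt hζ h1
  have hbdd : BddBelow (Set.range fun ζ : Set.Ico (1 : Ordinal.{0}) o =>
      ⨆ ξ : Set.Ico ζ.1 o, upperMean ξ.1 f) := by
    refine ⟨-C, ?_⟩
    rintro _ ⟨η, rfl⟩
    exact (abs_le.1 (hC η.1 η.2.2.le)).1.trans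
      (le_ciSup (f := fun ξ : Set.Ico η.1 o => upperMean ξ.1 f)
        ⟨C, by rintro _ ⟨ξ, rfl⟩; exact (abs_le.1 (hC ξ.1 ξ.2.2.le)).2⟩ ⟨η.1, le_rfl, η.2.2⟩)
  have : Nonempty (Set.Ico (max ζ 1) o) := ⟨⟨_, le_rfl, hz⟩⟩
  obtain ⟨ξ, hξ⟩ := exists_lt_of_lt_ciSup
    (hc.trans_le (ciInf_le hbdd ⟨max ζ 1, le_max_right _ _, hz⟩))
  exact ⟨ξ.1, (le_max_left _ _).trans ξ.2.1, ξ.2.2, hξ⟩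

theorem upperMean_eq_of_frequently {o : Ordinal.{0}} (h1 : 1 < o)
    (ho : IsPrincipal (· + ·) o) {f : Ordinal.{0} → ℝ} (hf : SeqBounded o f) {M : ℝ}
    {ζ₀ : Ordinal.{0}} (hζ₀ : ζ₀ < o) (hle : ∀ ξ, ζ₀ ≤ ξ → ξ < o → upperMean ξ f ≤ M)
    (hfreq : ∀ ζ < o, ∀ c < M, ∃ ξ, ζ ≤ ξ ∧ ξ < o ∧ c < upperMean ξ f) :
    upperMean o f = M := by
  apply le_antisymm
  · by_contra! h
    obtain ⟨ξ, hξ, hξo, hM⟩ := exists_lt_upperMean h1 ho hf h hζ₀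
    exact hM.not_ge (hle ξ hξ hξo)
  · by_contra! h
    obtain ⟨c, hc, hcM⟩ := exists_between h
    obtain ⟨ζ, hζ, hlt⟩ := exists_forall_upperMean_lt h1 ho hf hc
    obtain ⟨ξ, hξ, hξo, hM⟩ := hfreq ζ hζ c hcM
    exact hM.not_gt (hlt ξ hξ hξo)

theorem iSup_nat_lt_of_aleph0_lt_cof {o : Ordinal.{0}} (hcof : Cardinal.aleph0 < o.cof)
    {a : ℕ → Ordinal.{0}} (ha : ∀ n, a n < o) : ⨆ n, a n < o :=
  iSup_lt_of_lt_cof (by simpa using hcof) ha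

theorem exists_forall_upperMean_le {o : Ordinal.{0}} (h1 : 1 < o)
    (ho : IsPrincipal (· + ·) o) (hcof : Cardinal.aleph0 < o.cof) {f : Ordinal.{0} → ℝ}
    (hf : SeqBounded o f) :
    ∃ ζ < o, ∀ ξ, ζ ≤ ξ → ξ < o → upperMean ξ f ≤ upperMean o f := by
  have h (n : ℕ) := exists_forall_upperMean_lt h1 ho hf
    (lt_add_of_pos_right (upperMean o f) (Nat.one_div_pos_of_nat (n := n)))
  choose a ha hlt using h
  refine ⟨⨆ n, a n, iSup_nat_lt_of_aleph0_lt_cof hcof ha, fun ξ hξ hξo => ?_⟩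
  refine le_of_forall_pos_lt_add fun ε hε => ?_
  obtain ⟨n, hn⟩ := exists_nat_one_div_lt hε
  have := hlt n ξ ((Ordinal.le_iSup a n).trans hξ) hξo
  linarith

/-- Below an indecomposable ordinal of uncountable cofinality, there are arbitrarily large
indecomposable ordinals in which indices with upper mean close to `M` are cofinal. -/
theorem exists_isPrincipal_frequently {o : Ordinal.{0}} (h1 : 1 < o)
    (ho : IsPrincipal (· + ·) o) (hcof : Cardinal.aleph0 < o.cof) {f : Ordinal.{0} → ℝ} {M : ℝ}
    (hfreq : ∀ ζ < o, ∀ c < M, ∃ ξ, ζ ≤ ξ ∧ ξ < o ∧ c < upperMean ξ f)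
    {ζ₀ : Ordinal.{0}} (hζ₀ : ζ₀ < o) :
    ∃ ξ, ζ₀ < ξ ∧ ξ < o ∧ IsPrincipal (· + ·) ξ ∧
      ∀ ζ < ξ, ∀ c < M, ∃ η, ζ ≤ η ∧ η < ξ ∧ c < upperMean η f := by
  have hstep : ∀ (n : ℕ) (ζ : Ordinal.{0}), ∃ ζ', ζ < o →
      ζ' < o ∧ ζ < ζ' ∧ ζ + ζ < ζ' ∧
        ∃ η, ζ ≤ η ∧ η < ζ' ∧ M - 1 / ((n : ℝ) + 1) < upperMean η f := by
    intro n ζ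
    by_cases hζ : ζ < o
    · obtain ⟨η, h, h', h''⟩ := hfreq ζ hζ (M - 1 / ((n : ℝ) + 1))
        (sub_lt_self _ Nat.one_div_pos_of_nat)
      have hself : ζ ≤ ζ + ζ := le_self_add
      have hs : ∀ x y : Ordinal.{0}, x ≤ y → x < y + 1 := fun x y h => Order.lt_add_one_iff.2 h
      exact ⟨max (ζ + ζ) η + 1, fun _ => ⟨ho (max_lt (ho hζ hζ) h') h1,
        hs _ _ (hself.trans (le_max_left _ _)), hs _ _ (le_max_left _ _),
        η, h, hs _ _ (le_max_right _ _), h''⟩⟩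
    · exact ⟨0, fun h => absurd h hζ⟩
  choose step hs using hstep
  let a : ℕ → Ordinal.{0} := Nat.rec ζ₀ step
  have hao : ∀ n, a n < o := fun n => Nat.rec hζ₀ (fun n ih => (hs n _ ih).1) n
  have hmono : StrictMono a := strictMono_nat_of_lt_succ fun n => (hs n _ (hao n)).2.1
  have hlt : ∀ n, a n < ⨆ n, a n := fun n =>
    (hmono n.lt_succ_self).trans_le (Ordinal.le_iSup a (n + 1))
  refine ⟨⨆ n, a n, hlt 0, iSup_nat_lt_of_aleph0_lt_cof hcof hao, ?_, ?_⟩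
  · rw [isPrincipal_add_iff_add_self_lt]
    intro b hb
    obtain ⟨n, hn⟩ := Ordinal.lt_iSup_iff.1 hb
    calc b + b ≤ a n + a n := add_le_add hn.le hn.le
      _ < a (n + 1) := (hs n _ (hao n)).2.2.1
      _ ≤ _ := Ordinal.le_iSup a (n + 1)
  · intro ζ hζ c hc
    obtain ⟨n, hn⟩ := Ordinal.lt_iSup_iff.1 hζ
    obtain ⟨m, hm⟩ := exists_nat_one_div_lt (sub_pos.2 hc)
    obtain ⟨η, h, h', h''⟩ := (hs (max n m) _ (hao _)).2.2.2
    refine ⟨η, (hn.le.trans (hmono.monotone (le_max_left n m))).trans h,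
      h'.trans_le (Ordinal.le_iSup a (max n m + 1)), lt_of_le_of_lt ?_ h''⟩
    have := Nat.one_div_le_one_div (α := ℝ) (le_max_right n m)
    linarith

/-- Proposition 7.2.  Let `κ` be an infinite cardinal of
cofinality `> ω` and `s` a bounded sequence of length `κ` (as an ordinal `κ.ord`).
Then the set `{ξ < κ : M̄(s|_ξ) = M̄(s)}` (of nonzero such `ξ`) has a subset `C`
that is club in `κ`: unbounded in `κ`, and closed in `κ` in the sense that the
supremum of every nonempty subset of `C` bounded below `κ` belongs to `C`. -/
theorem upperMean_club (κ : Cardinal.{0}) (hκ : Cardinal.aleph0 ≤ κ)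
    (hcof : Cardinal.aleph0 < κ.ord.cof)
    (s : Ordinal.{0} → ℝ) (hs : SeqBounded κ.ord s) :
    ∃ C : Set Ordinal.{0},
      C ⊆ {ξ : Ordinal.{0} | 0 < ξ ∧ ξ < κ.ord ∧ upperMean ξ s = upperMean κ.ord s} ∧
      (∀ ζ < κ.ord, ∃ ξ ∈ C, ζ < ξ) ∧
      (∀ B ⊆ C, B.Nonempty → (∃ β < κ.ord, ∀ ξ ∈ B, ξ ≤ β) → sSup B ∈ C) := by
  have ho : IsPrincipal (· + ·) κ.ord := isPrincipal_add_ord hκ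
  have h1 : 1 < κ.ord := one_lt_omega0.trans_le (Cardinal.omega0_le_ord.2 hκ)
  obtain ⟨ζ₀, hζ₀, hle⟩ := exists_forall_upperMean_le h1 ho hcof hs
  refine ⟨{ξ | 1 < ξ ∧ ζ₀ < ξ ∧ ξ < κ.ord ∧ IsPrincipal (· + ·) ξ ∧
    ∀ ζ < ξ, ∀ c < upperMean κ.ord s, ∃ η, ζ ≤ η ∧ η < ξ ∧ c < upperMean η s}, ?_, ?_, ?_⟩
  · rintro ξ ⟨hξ1, hξ0, hξ, hp, hfreq⟩
    exact ⟨zero_lt_one.trans hξ1, hξ, upperMean_eq_of_frequently hξ1 hp (hs.mono hξ.le) hξ0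
      (fun η h h' => hle η h (h'.trans hξ)) hfreq⟩
  · intro ζ hζ
    obtain ⟨ξ, h, hξ, hp, hfreq⟩ := exists_isPrincipal_frequently h1 ho hcof
      (fun ζ hζ c hc => exists_lt_upperMean h1 ho hs hc hζ) (max_lt hζ (max_lt hζ₀ h1))
    simp only [max_lt_iff] at h
    exact ⟨ξ, ⟨h.2.2, h.2.1, hξ, hp, hfreq⟩, h.1⟩
  · rintro B hB ⟨b, hb⟩ ⟨β, hβ, hBβ⟩
    have hbdd : BddAbove B := ⟨β, hBβ⟩
    have hb' := le_csSup hbdd hb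
    refine ⟨(hB hb).1.trans_le hb', (hB hb).2.1.trans_le hb', (csSup_le ⟨b, hb⟩ hBβ).trans_lt hβ,
      IsPrincipal.sSup fun x hx => (hB hx).2.2.2.1, fun ζ hζ c hc => ?_⟩
    obtain ⟨x, hx, hζx⟩ := exists_lt_of_lt_csSup ⟨b, hb⟩ hζ
    obtain ⟨η, h, h', h''⟩ := (hB hx).2.2.2.2 ζ hζx c hc
    exact ⟨η, h, h'.trans_le (le_csSup hbdd hx), h''⟩
end

section
/- Let κ be an uncountable cardinal with cofinality κ (a regular uncountable cardinal), regarded as an ordinal. Let club(κ) = {A ⊆ κ : A contains a set that is club in κ}, let Σ be the σ-algebra on κ generated by club(κ), and define m : Σ → {0,1} by m(A) = 1 if A ∈ club(κ) and m(A) = 0 otherwise. Then Σ consists exactly of the members of club(κ) together with their complements, (κ, Σ, m) is a probability space, and no transfinite sequence x of elements of κ of length κ captures (κ, Σ, m); that is, for every x : {ξ : ξ < κ} → κ there exists A ∈ Σ with M̄(Ax) ≠ m(A). -/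
open Ordinal

open MeasureTheory
open scoped Classical

/-- A set `C` of ordinals is club in (the ordinal) `κo`: it consists of ordinals
`< κo`, is unbounded in `κo`, and is closed in `κo` (the least upper bound of each
nonempty subset of `C` bounded in `κo` belongs to `C`). -/
def IsClubIn (κo : Ordinal.{0}) (C : Set Ordinal.{0}) : Prop :=
  C ⊆ Set.Iio κo ∧ (∀ ζ < κo, ∃ ξ ∈ C, ζ < ξ) ∧
    ∀ B ⊆ C, B.Nonempty → (∃ β < κo, ∀ ξ ∈ B, ξ ≤ β) → sSup B ∈ C

/-- `A`, a set of ordinals below `κo`, belongs to the club filter on `κo`: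
it contains a club subset of `κo`. -/
def InClubFilter (κo : Ordinal.{0}) (A : Set {ξ : Ordinal.{0} // ξ < κo}) : Prop :=
  ∃ C : Set Ordinal.{0}, IsClubIn κo C ∧
    ∀ ξ : {ξ : Ordinal.{0} // ξ < κo}, ξ.1 ∈ C → ξ ∈ A

/-- The σ-algebra on the ordinals below `κo` generated by the club filter. -/
def clubSigma (κo : Ordinal.{0}) : MeasurableSpace {ξ : Ordinal.{0} // ξ < κo} :=
  MeasurableSpace.generateFrom {A | InClubFilter κo A}

section UpperMean

lemma natCast_stdBlocks (o : Ordinal.{0}) :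
    (stdBlocks o : Ordinal.{0}) = o / omega0 ^ log omega0 o := by
  obtain ⟨n, hn⟩ := lt_omega0.1 (div_opow_log_lt o one_lt_omega0)
  simp [stdBlocks, hn]

lemma stdBlocks_ne_zero {o : Ordinal.{0}} (ho : o ≠ 0) : stdBlocks o ≠ 0 := by
  intro h
  have h1 := natCast_stdBlocks o
  rw [h, Nat.cast_zero] at h1
  exact (div_opow_log_pos omega0 ho).ne h1

lemma block_index_lt {o ξ : Ordinal.{0}} {i : ℕ} (hi : i < stdBlocks o)
    (hξ : ξ < omega0 ^ log omega0 o) : omega0 ^ log omega0 o * (i : Ordinal.{0}) + ξ < o := by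
  calc omega0 ^ log omega0 o * (i : Ordinal.{0}) + ξ
      < omega0 ^ log omega0 o * (i : Ordinal.{0}) + omega0 ^ log omega0 o := by gcongr
    _ = omega0 ^ log omega0 o * ((i + 1 : ℕ) : Ordinal.{0}) := by
        rw [Nat.cast_succ, mul_add_one]
    _ ≤ omega0 ^ log omega0 o * (stdBlocks o : Ordinal.{0}) := by
        gcongr
        exact hi
    _ ≤ o := by
        rw [natCast_stdBlocks]
        exact mul_div_le _ _

lemma upperMean_one (f : Ordinal.{0} → ℝ) : upperMean 1 f = f 0 := by
  rw [upperMean, if_pos rfl]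

lemma upperMean_indecomposable {o : Ordinal.{0}} (h : 1 < o) (ho : o = omega0 ^ log omega0 o)
    (f : Ordinal.{0} → ℝ) :
    upperMean o f =
      ⨅ ζ : Set.Ico (1 : Ordinal.{0}) o, ⨆ ξ : Set.Ico ζ.1 o, upperMean ξ.1 f := by
  rw [upperMean, if_neg h.ne', dif_pos ⟨h, ho⟩]

lemma upperMean_decomposable {o : Ordinal.{0}} (h : 1 < o) (ho : o ≠ omega0 ^ log omega0 o)
    (f : Ordinal.{0} → ℝ) :
    upperMean o f = ((stdBlocks o : ℝ))⁻¹ * ∑ i ∈ Finset.range (stdBlocks o),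
        upperMean (omega0 ^ log omega0 o)
          (fun ξ => f (omega0 ^ log omega0 o * (i : Ordinal) + ξ)) := by
  rw [upperMean, if_neg h.ne', dif_neg (fun h' => ho h'.2), dif_pos h]

lemma one_le_omega0_opow (a : Ordinal.{0}) : 1 ≤ omega0 ^ a :=
  Order.one_le_iff_pos.2 (opow_pos _ omega0_pos)

lemma omega0_opow_log_lt {o : Ordinal.{0}} (h : 1 < o) (ho : o ≠ omega0 ^ log omega0 o) :
    omega0 ^ log omega0 o < o :=
  lt_of_le_of_ne (opow_log_le_self _ (zero_lt_one.trans h).ne') ho.symm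

lemma upperMean_mem_Icc {o : Ordinal.{0}} (h1 : 1 ≤ o) {f : Ordinal.{0} → ℝ}
    (hf : ∀ ξ, f ξ ∈ Set.Icc (0 : ℝ) 1) : upperMean o f ∈ Set.Icc (0 : ℝ) 1 := by
  induction o using WellFoundedLT.induction generalizing f with
  | ind o ih =>
  rcases h1.eq_or_lt with rfl | h1
  · rw [upperMean_one]
    exact hf 0
  by_cases ho : o = omega0 ^ log omega0 o
  · rw [upperMean_indecomposable h1 ho]
    have key (ζ : Set.Ico (1 : Ordinal.{0}) o) :
        (⨆ ξ : Set.Ico ζ.1 o, upperMean ξ.1 f) ∈ Set.Icc (0 : ℝ) 1 := by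
      have : Nonempty (Set.Ico ζ.1 o) := ⟨⟨ζ.1, le_rfl, ζ.2.2⟩⟩
      exact ⟨Real.iSup_nonneg fun ξ => (ih ξ.1 ξ.2.2 (ζ.2.1.trans ξ.2.1) hf).1,
        ciSup_le fun ξ => (ih ξ.1 ξ.2.2 (ζ.2.1.trans ξ.2.1) hf).2⟩
    exact ⟨Real.iInf_nonneg fun ζ => (key ζ).1,
      (ciInf_le ⟨0, by rintro _ ⟨ζ, rfl⟩; exact (key ζ).1⟩ ⟨1, le_rfl, h1⟩).trans (key _).2⟩
  · rw [upperMean_decomposable h1 ho]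
    have key (i : ℕ) := ih _ (omega0_opow_log_lt h1 ho) (one_le_omega0_opow _)
      (f := fun ξ => f (omega0 ^ log omega0 o * (i : Ordinal) + ξ)) (fun ξ => hf _)
    refine ⟨mul_nonneg (by positivity) (Finset.sum_nonneg fun i _ => (key i).1), ?_⟩
    rw [inv_mul_le_iff₀ (by
      exact_mod_cast Nat.pos_of_ne_zero (stdBlocks_ne_zero (zero_lt_one.trans h1).ne'))]
    simpa using Finset.sum_le_sum fun i (_ : i ∈ Finset.range (stdBlocks o)) => (key i).2

lemma bddAbove_upperMean {o ζ : Ordinal.{0}} (hζ : 1 ≤ ζ) {f : Ordinal.{0} → ℝ}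
    (hf : ∀ ξ, f ξ ∈ Set.Icc (0 : ℝ) 1) :
    BddAbove (Set.range fun ξ : Set.Ico ζ o => upperMean ξ.1 f) :=
  ⟨1, by rintro _ ⟨ξ, rfl⟩; exact (upperMean_mem_Icc (hζ.trans ξ.2.1) hf).2⟩

lemma bddBelow_iSup_upperMean {o : Ordinal.{0}} {f : Ordinal.{0} → ℝ}
    (hf : ∀ ξ, f ξ ∈ Set.Icc (0 : ℝ) 1) :
    BddBelow (Set.range fun ζ : Set.Ico (1 : Ordinal.{0}) o =>
      ⨆ ξ : Set.Ico ζ.1 o, upperMean ξ.1 f) :=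
  ⟨0, by
    rintro _ ⟨ζ, rfl⟩
    exact Real.iSup_nonneg fun ξ => (upperMean_mem_Icc (ζ.2.1.trans ξ.2.1) hf).1⟩

lemma upperMean_const_one {o : Ordinal.{0}} (h1 : 1 ≤ o) : upperMean o (fun _ => 1) = 1 := by
  induction o using WellFoundedLT.induction with
  | ind o ih =>
  rcases h1.eq_or_lt with rfl | h1
  · rw [upperMean_one]
  by_cases ho : o = omega0 ^ log omega0 o
  · rw [upperMean_indecomposable h1 ho]
    have : Nonempty (Set.Ico (1 : Ordinal.{0}) o) := ⟨⟨1, le_rfl, h1⟩⟩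
    have key (ζ : Set.Ico (1 : Ordinal.{0}) o) :
        (⨆ ξ : Set.Ico ζ.1 o, upperMean ξ.1 (fun _ => 1)) = 1 := by
      have : Nonempty (Set.Ico ζ.1 o) := ⟨⟨ζ.1, le_rfl, ζ.2.2⟩⟩
      rw [iSup_congr fun ξ : Set.Ico ζ.1 o => ih ξ.1 ξ.2.2 (ζ.2.1.trans ξ.2.1), ciSup_const]
    rw [iInf_congr key, ciInf_const]
  · rw [upperMean_decomposable h1 ho, ih _ (omega0_opow_log_lt h1 ho) (one_le_omega0_opow _)]
    have := stdBlocks_ne_zero (zero_lt_one.trans h1).ne'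
    simp [this]

/-- Upper means of `[0, 1]`-valued sequences are subadditive and monotone, and depend only on
the entries below the length. -/
lemma upperMean_le_add {o : Ordinal.{0}} (h1 : 1 ≤ o) {f g h : Ordinal.{0} → ℝ}
    (hf : ∀ ξ, f ξ ∈ Set.Icc (0 : ℝ) 1) (hg : ∀ ξ, g ξ ∈ Set.Icc (0 : ℝ) 1)
    (hh : ∀ ξ, h ξ ∈ Set.Icc (0 : ℝ) 1) (hle : ∀ ξ < o, h ξ ≤ f ξ + g ξ) :
    upperMean o h ≤ upperMean o f + upperMean o g := by
  induction o using WellFoundedLT.induction generalizing f g h with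
  | ind o ih =>
  rcases h1.eq_or_lt with rfl | h1
  · simp only [upperMean_one]
    exact hle 0 zero_lt_one
  by_cases ho : o = omega0 ^ log omega0 o
  · simp only [upperMean_indecomposable h1 ho]
    have : Nonempty (Set.Ico (1 : Ordinal.{0}) o) := ⟨⟨1, le_rfl, h1⟩⟩
    refine le_ciInf_add_ciInf fun ζ₁ ζ₂ => ?_
    refine (ciInf_le (bddBelow_iSup_upperMean hh)
      ⟨max ζ₁.1 ζ₂.1, ζ₁.2.1.trans (le_max_left _ _), max_lt ζ₁.2.2 ζ₂.2.2⟩).trans ?_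
    have : Nonempty (Set.Ico (max ζ₁.1 ζ₂.1) o) := ⟨⟨_, le_rfl, max_lt ζ₁.2.2 ζ₂.2.2⟩⟩
    refine ciSup_le fun ξ => ?_
    have h₁ : ζ₁.1 ≤ ξ.1 := (le_max_left _ _).trans ξ.2.1
    have h₂ : ζ₂.1 ≤ ξ.1 := (le_max_right _ _).trans ξ.2.1
    refine (ih ξ.1 ξ.2.2 (ζ₁.2.1.trans h₁) hf hg hh
      fun η hη => hle η (hη.trans ξ.2.2)).trans (add_le_add ?_ ?_)
    · exact le_ciSup (bddAbove_upperMean (o := o) ζ₁.2.1 hf) ⟨ξ.1, h₁, ξ.2.2⟩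
    · exact le_ciSup (bddAbove_upperMean (o := o) ζ₂.2.1 hg) ⟨ξ.1, h₂, ξ.2.2⟩
  · simp only [upperMean_decomposable h1 ho]
    rw [← mul_add, ← Finset.sum_add_distrib]
    refine mul_le_mul_of_nonneg_left (Finset.sum_le_sum fun i hi => ?_) (by positivity)
    exact ih _ (omega0_opow_log_lt h1 ho) (one_le_omega0_opow _) (fun _ => hf _) (fun _ => hg _)
      (fun _ => hh _) fun ξ hξ => hle _ (block_index_lt (Finset.mem_range.1 hi) hξ)

end UpperMean

lemma exists_ord_bound {κ : Cardinal.{0}} (hreg : κ.ord.cof = κ)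
    {a : Ordinal.{0}} (ha : a < κ.ord) {f : Ordinal.{0} → Ordinal.{0}}
    (hf : ∀ i < a, f i < κ.ord) : ∃ b < κ.ord, ∀ i < a, f i < b := by
  have hcard : Cardinal.lift.{0} (Cardinal.mk (Set.Iio a)) < (lift.{1} κ.ord).cof := by
    rw [Cardinal.mk_Iio_ordinal, ← lift_cof, hreg, Cardinal.lift_lift, Cardinal.lift_lt]
    exact Cardinal.lt_ord.1 ha
  refine ⟨⨆ i : Set.Iio a, f i + 1,
    lift_iSup_add_one_lt_of_lt_cof hcard fun i => hf i.1 i.2, fun i hi => ?_⟩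
  exact (Order.lt_add_one_iff.2 le_rfl).trans_le
    (Ordinal.le_iSup (fun i : Set.Iio a => f i + 1) ⟨i, hi⟩)

lemma isSuccLimit_ord {κ : Cardinal.{0}} (hκ : Cardinal.aleph0 < κ) :
    Order.IsSuccLimit κ.ord :=
  Cardinal.isSuccLimit_ord hκ.le

/-- The nonzero points below `κo` closed under `b`. -/
def closurePoints (κo : Ordinal.{0}) (b : Ordinal.{0} → Ordinal.{0}) : Set Ordinal.{0} :=
  {γ | 0 < γ ∧ γ < κo ∧ ∀ α < γ, b α ≤ γ}

lemma isClubIn_closurePoints {κ : Cardinal.{0}} (hκ : Cardinal.aleph0 < κ)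
    (hreg : κ.ord.cof = κ) {b : Ordinal.{0} → Ordinal.{0}} (hb : ∀ α < κ.ord, b α < κ.ord) :
    IsClubIn κ.ord (closurePoints κ.ord b) := by
  refine ⟨fun γ hγ => hγ.2.1, fun ζ hζ => ?_, fun B hB hne ⟨β, hβ, hBβ⟩ => ?_⟩
  · have hstep (α : Ordinal.{0}) : ∃ c, α < κ.ord → c < κ.ord ∧ ∀ i < α, b i < c := by
      by_cases hα : α < κ.ord
      · obtain ⟨c, hc⟩ := exists_ord_bound hreg hα fun i hi => hb i (hi.trans hα)
        exact ⟨c, fun _ => hc⟩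
      · exact ⟨0, fun h => (hα h).elim⟩
    choose c hc using hstep
    have hlt : ∀ i < κ.ord, c i < κ.ord := fun i hi => (hc i hi).1
    have hζ1 : ζ + 1 < κ.ord := (isSuccLimit_ord hκ).add_one_lt hζ
    have hit (n : ℕ) : c^[n] (ζ + 1) < κ.ord := by
      induction n with
      | zero => exact hζ1
      | succ n ih =>
        rw [Function.iterate_succ_apply']
        exact hlt _ ih
    have hζγ : ζ < nfp c (ζ + 1) := (Order.lt_add_one_iff.2 le_rfl).trans_le (le_nfp _ _)
    refine ⟨nfp c (ζ + 1), ⟨bot_le.trans_lt hζγ, ?_, fun α hα => ?_⟩, hζγ⟩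
    · exact nfp_lt_ord (by rwa [hreg]) hlt hζ1
    · obtain ⟨n, hn⟩ := lt_nfp_iff.1 hα
      refine ((hc _ (hit n)).2 α hn).le.trans ?_
      rw [← Function.iterate_succ_apply' c]
      exact iterate_le_nfp _ _ _
  · have hbdd : BddAbove B := ⟨β, hBβ⟩
    obtain ⟨γ, hγ⟩ := hne
    refine ⟨(hB hγ).1.trans_le (le_csSup hbdd hγ), (csSup_le ⟨γ, hγ⟩ hBβ).trans_lt hβ,
      fun α hα => ?_⟩
    obtain ⟨δ, hδ, hαδ⟩ := exists_lt_of_lt_csSup ⟨γ, hγ⟩ hα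
    exact ((hB hδ).2.2 α hαδ).trans (le_csSup hbdd hδ)

lemma IsClubIn.exists_closurePoints_subset {κo : Ordinal.{0}} {C : Set Ordinal.{0}}
    (hC : IsClubIn κo C) :
    ∃ b : Ordinal.{0} → Ordinal.{0}, (∀ α < κo, b α < κo) ∧ closurePoints κo b ⊆ C := by
  have hstep (α : Ordinal.{0}) : ∃ c, α < κo → c ∈ C ∧ α < c := by
    by_cases hα : α < κo
    · obtain ⟨c, hc⟩ := hC.2.1 α hα
      exact ⟨c, fun _ => hc⟩
    · exact ⟨0, fun h => (hα h).elim⟩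
  choose c hc using hstep
  refine ⟨c, fun α hα => hC.1 (hc α hα).1, fun γ ⟨h0, hγ, hcl⟩ => ?_⟩
  have hle : ∀ ξ ∈ c '' Set.Iio γ, ξ ≤ γ := by
    rintro _ ⟨α, hα, rfl⟩
    exact hcl α hα
  have hsup : sSup (c '' Set.Iio γ) = γ := by
    refine le_antisymm (csSup_le ⟨c 0, 0, h0, rfl⟩ hle) (le_of_forall_lt fun α hα => ?_)
    exact (hc α (hα.trans hγ)).2.trans_le (le_csSup ⟨γ, hle⟩ ⟨α, hα, rfl⟩)
  rw [← hsup]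
  refine hC.2.2 _ ?_ ⟨c 0, 0, h0, rfl⟩ ⟨γ, hγ, hle⟩
  rintro _ ⟨α, hα, rfl⟩
  exact (hc α (lt_trans hα hγ)).1

section ClubFilter

variable {κ : Cardinal.{0}}

lemma inClubFilter_iff (hκ : Cardinal.aleph0 < κ) (hreg : κ.ord.cof = κ)
    {A : Set {ξ : Ordinal.{0} // ξ < κ.ord}} :
    InClubFilter κ.ord A ↔ ∃ b : Ordinal.{0} → Ordinal.{0}, (∀ α < κ.ord, b α < κ.ord) ∧
      ∀ ξ : {ξ : Ordinal.{0} // ξ < κ.ord}, ξ.1 ∈ closurePoints κ.ord b → ξ ∈ A := by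
  constructor
  · rintro ⟨C, hC, hCA⟩
    obtain ⟨b, hb, hbC⟩ := hC.exists_closurePoints_subset
    exact ⟨b, hb, fun ξ hξ => hCA ξ (hbC hξ)⟩
  · rintro ⟨b, hb, hbA⟩
    exact ⟨_, isClubIn_closurePoints hκ hreg hb, hbA⟩

lemma InClubFilter.mono {κo : Ordinal.{0}} {A B : Set {ξ : Ordinal.{0} // ξ < κo}}
    (hA : InClubFilter κo A) (h : A ⊆ B) : InClubFilter κo B :=
  let ⟨C, hC, hCA⟩ := hA
  ⟨C, hC, fun ξ hξ => h (hCA ξ hξ)⟩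

lemma inClubFilter_univ (hκ : Cardinal.aleph0 < κ) (hreg : κ.ord.cof = κ) :
    InClubFilter κ.ord Set.univ :=
  (inClubFilter_iff hκ hreg).2 ⟨id, fun _ h => h, fun _ _ => trivial⟩

lemma not_inClubFilter_empty (hκ : Cardinal.aleph0 < κ) : ¬ InClubFilter κ.ord ∅ := by
  rintro ⟨C, hC, hCA⟩
  obtain ⟨ξ, hξ, -⟩ := hC.2.1 0 (isSuccLimit_ord hκ).bot_lt
  exact hCA ⟨ξ, hC.1 hξ⟩ hξ

lemma InClubFilter.iInter (hκ : Cardinal.aleph0 < κ) (hreg : κ.ord.cof = κ)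
    {A : ℕ → Set {ξ : Ordinal.{0} // ξ < κ.ord}} (hA : ∀ n, InClubFilter κ.ord (A n)) :
    InClubFilter κ.ord (⋂ n, A n) := by
  simp only [inClubFilter_iff hκ hreg] at hA ⊢
  choose b hb hbA using hA
  refine ⟨fun α => ⨆ n, b n α, fun α hα => ?_, fun ξ hξ => Set.mem_iInter.2 fun n => ?_⟩
  · refine iSup_lt_of_lt_cof ?_ fun n => hb n α hα
    rwa [hreg, Cardinal.mk_nat]
  · exact hbA n ξ ⟨hξ.1, hξ.2.1, fun α hα =>
      (Ordinal.le_iSup (fun n => b n α) n).trans (hξ.2.2 α hα)⟩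

lemma InClubFilter.inter (hκ : Cardinal.aleph0 < κ) (hreg : κ.ord.cof = κ)
    {A B : Set {ξ : Ordinal.{0} // ξ < κ.ord}} (hA : InClubFilter κ.ord A)
    (hB : InClubFilter κ.ord B) : InClubFilter κ.ord (A ∩ B) := by
  refine (InClubFilter.iInter hκ hreg (A := fun n => if n = 0 then A else B) fun n => ?_).mono
    fun ξ hξ => ?_
  · split_ifs
    exacts [hA, hB]
  · rw [Set.mem_iInter] at hξ
    exact ⟨by simpa using hξ 0, by simpa using hξ 1⟩

lemma InClubFilter.not_of_disjoint (hκ : Cardinal.aleph0 < κ) (hreg : κ.ord.cof = κ)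
    {A B : Set {ξ : Ordinal.{0} // ξ < κ.ord}} (hA : InClubFilter κ.ord A)
    (hAB : Disjoint A B) : ¬ InClubFilter κ.ord B := fun hB =>
  not_inClubFilter_empty hκ (hAB.inter_eq ▸ hA.inter hκ hreg hB)

lemma measurableSet_clubSigma_iff (hκ : Cardinal.aleph0 < κ) (hreg : κ.ord.cof = κ)
    (A : Set {ξ : Ordinal.{0} // ξ < κ.ord}) :
    MeasurableSet[clubSigma κ.ord] A ↔ (InClubFilter κ.ord A ∨ InClubFilter κ.ord Aᶜ) := by
  constructor
  · intro h
    induction A, h using MeasurableSpace.generateFrom_induction with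
    | hC A hA => exact Or.inl hA
    | empty => exact Or.inr (by simpa using inClubFilter_univ hκ hreg)
    | compl A _ ih => rwa [compl_compl, or_comm]
    | iUnion A _ ih =>
      by_cases hex : ∃ n, InClubFilter κ.ord (A n)
      · obtain ⟨n, hn⟩ := hex
        exact Or.inl (hn.mono (Set.subset_iUnion A n))
      · rw [Set.compl_iUnion]
        exact Or.inr (.iInter hκ hreg fun n => (ih n).resolve_left fun h => hex ⟨n, h⟩)
  · rintro (h | h)
    · exact MeasurableSpace.measurableSet_generateFrom h
    · rw [← compl_compl A]
      exact (MeasurableSpace.measurableSet_generateFrom (s := {A | InClubFilter κ.ord A}) h).compl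

lemma exists_clubMeasure (hκ : Cardinal.aleph0 < κ) (hreg : κ.ord.cof = κ) :
    ∃ μ : @MeasureTheory.Measure {ξ : Ordinal.{0} // ξ < κ.ord} (clubSigma κ.ord),
      ∀ A : Set {ξ : Ordinal.{0} // ξ < κ.ord}, MeasurableSet[clubSigma κ.ord] A →
        μ A = (if InClubFilter κ.ord A then 1 else 0) := by
  let _ := clubSigma κ.ord
  refine ⟨Measure.ofMeasurable (fun A _ => if InClubFilter κ.ord A then 1 else 0)
    (if_neg (not_inClubFilter_empty hκ)) fun A hA hdisj => ?_,
    fun A hA => Measure.ofMeasurable_apply A hA⟩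
  by_cases hex : ∃ n, InClubFilter κ.ord (A n)
  · obtain ⟨n, hn⟩ := hex
    rw [if_pos (hn.mono (Set.subset_iUnion A n)), tsum_eq_single n, if_pos hn]
    exact fun m hm => if_neg (hn.not_of_disjoint hκ hreg (hdisj hm.symm))
  · push Not at hex
    have hcompl : InClubFilter κ.ord (⋃ n, A n)ᶜ := by
      rw [Set.compl_iUnion]
      exact .iInter hκ hreg fun n =>
        ((measurableSet_clubSigma_iff hκ hreg _).1 (hA n)).resolve_left (hex n)
    rw [if_neg (hcompl.not_of_disjoint hκ hreg disjoint_compl_left)]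
    simp [hex]

lemma inClubFilter_compl_Iic (hκ : Cardinal.aleph0 < κ) (hreg : κ.ord.cof = κ)
    {α : Ordinal.{0}} (hα : α < κ.ord) :
    InClubFilter κ.ord {η : {ξ : Ordinal.{0} // ξ < κ.ord} | η.1 ≤ α}ᶜ :=
  (inClubFilter_iff hκ hreg).2 ⟨fun _ => α + 1,
    fun _ _ => (isSuccLimit_ord hκ).add_one_lt hα, fun ξ hξ => by
      simpa using Order.add_one_le_iff.1 (hξ.2.2 0 hξ.1)⟩

lemma ord_eq_omega0_opow_log (hκ : Cardinal.aleph0 < κ) :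
    κ.ord = omega0 ^ log omega0 κ.ord := by
  rcases isPrincipal_add_iff_zero_or_omega0_opow.1 (isPrincipal_add_ord hκ.le) with
    h | ⟨a, ha⟩
  · exact absurd h (isSuccLimit_ord hκ).bot_lt.ne'
  · simp only at ha
    rw [← ha, log_opow one_lt_omega0]

lemma indicator_one_mem_Icc {α : Type*} (A : Set α) (a : α) :
    A.indicator (fun _ => (1 : ℝ)) a ∈ Set.Icc (0 : ℝ) 1 := by
  by_cases h : a ∈ A <;> simp [h]

/-- If every measurable set had upper mean equal to its measure along `x`, each bounded set would
have small upper mean along every long enough initial segment of `x`; the complement of a suitable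
club set then contains, for unboundedly many `ξ`, at least half of the first `ξ` entries. -/
lemma exists_upperMean_ne (hκ : Cardinal.aleph0 < κ) (hreg : κ.ord.cof = κ)
    (x : Ordinal.{0} → {ξ : Ordinal.{0} // ξ < κ.ord}) :
    ∃ A : Set {ξ : Ordinal.{0} // ξ < κ.ord}, MeasurableSet[clubSigma κ.ord] A ∧
      upperMean κ.ord (fun ξ => A.indicator (fun _ => (1 : ℝ)) (x ξ)) ≠
        (if InClubFilter κ.ord A then 1 else 0) := by
  by_contra! hcap
  have hone : 1 < κ.ord := by
    simpa using (isSuccLimit_ord hκ).add_one_lt (isSuccLimit_ord hκ).bot_lt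
  have hnull (A : Set {ξ : Ordinal.{0} // ξ < κ.ord}) (hA : InClubFilter κ.ord Aᶜ) :
      (⨅ ζ : Set.Ico (1 : Ordinal.{0}) κ.ord, ⨆ ξ : Set.Ico ζ.1 κ.ord,
        upperMean ξ.1 (fun ξ => A.indicator (fun _ => (1 : ℝ)) (x ξ))) = 0 := by
    rw [← upperMean_indecomposable hone (ord_eq_omega0_opow_log hκ),
      hcap A ((measurableSet_clubSigma_iff hκ hreg A).2 (Or.inr hA)),
      if_neg (hA.not_of_disjoint hκ hreg disjoint_compl_left)]
  have : Nonempty (Set.Ico (1 : Ordinal.{0}) κ.ord) := ⟨⟨1, le_rfl, hone⟩⟩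
  have hstep (α : Ordinal.{0}) : ∃ ξ b : Ordinal.{0}, α < κ.ord →
      b < κ.ord ∧ α ≤ ξ ∧ 1 ≤ ξ ∧ ξ < κ.ord ∧ (∀ η < ξ, (x η).1 < b) ∧
      upperMean ξ (fun ξ => {η : {ξ : Ordinal.{0} // ξ < κ.ord} | η.1 ≤ α}.indicator
        (fun _ => (1 : ℝ)) (x ξ)) < 1 / 2 := by
    by_cases hα : α < κ.ord
    swap
    · exact ⟨0, 0, fun h => (hα h).elim⟩
    obtain ⟨ζ, hζ⟩ := exists_lt_of_ciInf_lt
      ((hnull _ (inClubFilter_compl_Iic hκ hreg hα)).trans_lt one_half_pos)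
    have hξ : max ζ.1 α < κ.ord := max_lt ζ.2.2 hα
    obtain ⟨b, hb, hxb⟩ := exists_ord_bound hreg hξ (f := fun η => (x η).1) fun η _ => (x η).2
    refine ⟨max ζ.1 α, b, fun _ => ⟨hb, le_max_right _ _, ζ.2.1.trans (le_max_left _ _), hξ, hxb,
      lt_of_le_of_lt ?_ hζ⟩⟩
    exact le_ciSup (bddAbove_upperMean (o := κ.ord) ζ.2.1 fun ξ => indicator_one_mem_Icc _ _)
      ⟨max ζ.1 α, le_max_left _ _, hξ⟩
  choose ξ b hstep using hstep
  let A : Set {ξ : Ordinal.{0} // ξ < κ.ord} := {η | η.1 ∉ closurePoints κ.ord b}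
  have hA : InClubFilter κ.ord Aᶜ :=
    (inClubFilter_iff hκ hreg).2 ⟨b, fun α hα => (hstep α hα).1, fun η hη => by simpa [A] using hη⟩
  have hlarge (α : Ordinal.{0}) (hα : α < κ.ord) :
      1 / 2 ≤ upperMean (ξ α) (fun ξ => A.indicator (fun _ => (1 : ℝ)) (x ξ)) := by
    obtain ⟨-, -, h1, -, hxb, hhalf⟩ := hstep α hα
    have hadd := upperMean_le_add (h := fun _ => 1) h1
      (fun ξ => indicator_one_mem_Icc {η : {ξ : Ordinal.{0} // ξ < κ.ord} | η.1 ≤ α} (x ξ))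
      (fun ξ => indicator_one_mem_Icc A (x ξ)) (fun _ => ⟨zero_le_one, le_rfl⟩) fun η hη => by
        by_cases hle : (x η).1 ≤ α
        · have := (indicator_one_mem_Icc A (x η)).1
          rw [Set.indicator_of_mem (show x η ∈ {η : {ξ // ξ < κ.ord} | η.1 ≤ α} from hle)]
          linarith
        · have hmem : x η ∈ A := fun hcl =>
            ((hxb η hη).trans_le (hcl.2.2 α (not_le.1 hle))).false
          have := (indicator_one_mem_Icc
            {η : {ξ : Ordinal.{0} // ξ < κ.ord} | η.1 ≤ α} (x η)).1
          rw [Set.indicator_of_mem hmem]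
          linarith
    rw [upperMean_const_one h1] at hadd
    linarith
  have hge : (1 / 2 : ℝ) ≤ 0 := by
    rw [← hnull A hA]
    refine le_ciInf fun ζ => ?_
    obtain ⟨-, hle, -, hlt, -⟩ := hstep ζ.1 ζ.2.2
    exact (hlarge ζ.1 ζ.2.2).trans (le_ciSup
      (bddAbove_upperMean (o := κ.ord) ζ.2.1 fun ξ => indicator_one_mem_Icc _ _) ⟨ξ ζ.1, hle, hlt⟩)
  norm_num at hge

end ClubFilter

/-- Theorem: the club filter is not captured.  Let `κ` be a
regular uncountable cardinal.  Let `Σ` be the σ-algebra on (the ordinals below)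
`κ` generated by the club filter, and let `m A = 1` if `A` contains a club set and
`m A = 0` otherwise.  Then: `Σ` consists exactly of the club-filter sets and their
complements; `m` is a probability measure on `Σ`; and no transfinite sequence `x`
of elements of `κ` of length `κ` captures `(κ, Σ, m)` — every such `x` admits a
measurable `A` with `M̄(Ax) ≠ m A`. -/
theorem club_filter_not_captured (κ : Cardinal.{0})
    (hκ : Cardinal.aleph0 < κ) (hreg : κ.ord.cof = κ) :
    (∀ A : Set {ξ : Ordinal.{0} // ξ < κ.ord},
        MeasurableSet[clubSigma κ.ord] A ↔
          (InClubFilter κ.ord A ∨ InClubFilter κ.ord Aᶜ)) ∧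
    (∃ μ : @MeasureTheory.Measure {ξ : Ordinal.{0} // ξ < κ.ord} (clubSigma κ.ord),
        μ Set.univ = 1 ∧
        ∀ A : Set {ξ : Ordinal.{0} // ξ < κ.ord}, MeasurableSet[clubSigma κ.ord] A →
          μ A = (if InClubFilter κ.ord A then 1 else 0)) ∧
    (∀ x : Ordinal.{0} → {ξ : Ordinal.{0} // ξ < κ.ord},
        ∃ A : Set {ξ : Ordinal.{0} // ξ < κ.ord}, MeasurableSet[clubSigma κ.ord] A ∧
          upperMean κ.ord (fun ξ => A.indicator (fun _ => (1 : ℝ)) (x ξ)) ≠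
            (if InClubFilter κ.ord A then 1 else 0)) := by
  obtain ⟨μ, hμ⟩ := exists_clubMeasure hκ hreg
  refine ⟨measurableSet_clubSigma_iff hκ hreg, ⟨μ, ?_, hμ⟩, exists_upperMean_ne hκ hreg⟩
  rw [hμ _ (@MeasurableSet.univ _ (clubSigma κ.ord)), if_pos (inClubFilter_univ hκ hreg)]
end
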